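/- arXiv:2510.18367 — 2 statements merged into one kernel-verified Lean document; each statement's English description precedes it below -/
import Mathlib

section
/- Let p ≥ 1 and let p_1, p_2 be Borel probability measures on the circle S¹ with circular cumulative distribution functions P_1, P_2, and for α ∈ ℝ set P_{2,α}(x) = P_2(x) − α. Then the function α ↦ ∫_0^1 |P_1^{-1}(u) − P_{2,α}^{-1}(u)|^p du is convex on ℝ, where F^{-1}(u) = inf{x ∈ ℝ : F(x) ≥ u}. -/
open MeasureTheory Real Filter
open scoped ENNReal

/-- The circle `S¹` is identified with `[0, 2π)` endowed with the metric
`d(x,y) = min(|x−y|, 2π−|x−y|)`. -/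
noncomputable def circleDist (x y : ℝ) : ℝ := min |x - y| (2 * π - |x - y|)

/-- A Borel probability measure on the circle, identified with a Borel probability
measure on `ℝ` giving full mass to `[0, 2π)`. -/
def IsCircleProb (μ : Measure ℝ) : Prop :=
  IsProbabilityMeasure μ ∧ μ (Set.Ico 0 (2 * π)) = 1

/-- The `L^p` Wasserstein distance on the circle. -/
noncomputable def circleW (p : ℝ) (μ ν : Measure ℝ) : ℝ≥0∞ :=
  ⨅ γ ∈ {γ : Measure (ℝ × ℝ) | IsProbabilityMeasure γ ∧ γ.map Prod.fst = μ ∧ γ.map Prod.snd = ν},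
    (∫⁻ z, ENNReal.ofReal (circleDist z.1 z.2) ^ p ∂γ) ^ (1 / p)

/-- The circular cumulative distribution function of a probability measure on the circle:
`Q(x) = q([0, x])` for `0 ≤ x < 2π`, extended to `ℝ` by `Q(x ± 2π) = Q(x) ± 1`. -/
noncomputable def circleCDF (q : Measure ℝ) (x : ℝ) : ℝ :=
  (⌊x / (2 * π)⌋ : ℝ) + (q (Set.Icc 0 (2 * π * Int.fract (x / (2 * π))))).toReal

/-- The generalized inverse `F^{-1}(u) = inf {x ∈ ℝ : F(x) ≥ u}`. -/
noncomputable def geninv (F : ℝ → ℝ) (u : ℝ) : ℝ := sInf {x : ℝ | u ≤ F x}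

open Topology

/-- A continuous midpoint-convex function on `ℝ` is convex. -/
theorem convexOn_univ_of_continuous_of_midpoint {f : ℝ → ℝ} (hf : Continuous f)
    (hmid : ∀ x h : ℝ, 0 ≤ h → 2 * f (x + h) ≤ f x + f (x + 2 * h)) :
    ConvexOn ℝ Set.univ f := by
  refine LinearOrder.convexOn_of_lt convex_univ fun x _ y _ hxy a b ha hb hab => ?_
  simp only [smul_eq_mul]
  by_contra! hlt
  obtain ⟨k, hk⟩ : ∃ k, k * (y - x) = f y - f x :=
    ⟨(f y - f x) / (y - x), div_mul_cancel₀ _ (by linarith)⟩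
  set g : ℝ → ℝ := fun z => f z - f x - (z - x) * k with hg
  have hgc : Continuous g := by fun_prop
  have hgmid : ∀ z h : ℝ, 0 ≤ h → 2 * g (z + h) ≤ g z + g (z + 2 * h) := by
    intro z h hh
    have := hmid z h hh
    simp only [hg]
    linarith
  have hgx : g x = 0 := by simp [hg]
  have hgy : g y = 0 := by simp only [hg]; linarith
  obtain rfl : b = 1 - a := by linarith
  have hm : a * x + (1 - a) * y ∈ Set.Icc x y := by
    constructor <;> nlinarith
  have hgm : 0 < g (a * x + (1 - a) * y) := by
    simp only [hg]
    linear_combination hlt + (1 - a) * hk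
  obtain ⟨c₀, hc₀, hmax⟩ := isCompact_Icc.exists_isMaxOn ⟨_, hm⟩ hgc.continuousOn
  have hK : IsCompact (Set.Icc x y ∩ g ⁻¹' {g c₀}) :=
    isCompact_Icc.inter_right (isClosed_singleton.preimage hgc)
  obtain ⟨c, ⟨⟨hxc, hcy⟩, hc⟩, hleast⟩ := hK.exists_isLeast ⟨c₀, hc₀, rfl⟩
  have hc : g c = g c₀ := hc
  have hpos : 0 < g c := by rw [hc]; exact hgm.trans_le (hmax hm)
  have hxc' : x < c := lt_of_le_of_ne hxc (by rintro rfl; linarith)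
  have hcy' : c < y := lt_of_le_of_ne hcy (by rintro rfl; linarith)
  obtain ⟨h, h0, h1, h2⟩ : ∃ h, 0 < h ∧ h ≤ c - x ∧ h ≤ y - c :=
    ⟨min (c - x) (y - c), lt_min (by linarith) (by linarith), min_le_left _ _, min_le_right _ _⟩
  have hl : c - h ∈ Set.Icc x y := ⟨by linarith, by linarith⟩
  have hr : c + h ∈ Set.Icc x y := ⟨by linarith, by linarith⟩
  have hlne : g (c - h) ≠ g c₀ := fun he => by
    have := hleast ⟨hl, he⟩
    linarith
  have hllt : g (c - h) < g c₀ := lt_of_le_of_ne (hmax hl) hlne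
  have hrle : g (c + h) ≤ g c₀ := hmax hr
  have := hgmid (c - h) h h0.le
  rw [sub_add_cancel, show c - h + 2 * h = c + h by ring] at this
  linarith

/-- The Monge inequality for the cost `(x, y) ↦ φ (x - y)` with `φ` convex. -/
theorem ConvexOn.monge {φ : ℝ → ℝ} (hφ : ConvexOn ℝ Set.univ φ) {x x' y y' : ℝ}
    (hx : x ≤ x') (hy : y ≤ y') :
    φ (x - y) + φ (x' - y') ≤ φ (x - y') + φ (x' - y) := by
  rcases hx.eq_or_lt with rfl | hx
  · linarith
  have hd : 0 < (x' - x) + (y' - y) := by linarith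
  set s := (x' - x) / ((x' - x) + (y' - y)) with hs
  have hsd : s * ((x' - x) + (y' - y)) = x' - x := div_mul_cancel₀ _ hd.ne'
  have hs0 : 0 ≤ s := div_nonneg (by linarith) hd.le
  have hs1 : 0 ≤ 1 - s := by
    rw [sub_nonneg, hs, div_le_one hd]
    linarith
  have e₁ := hφ.2 (Set.mem_univ (x - y')) (Set.mem_univ (x' - y)) hs0 hs1 (by ring)
  have e₂ := hφ.2 (Set.mem_univ (x - y')) (Set.mem_univ (x' - y)) hs1 hs0 (by ring)
  simp only [smul_eq_mul] at e₁ e₂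
  rw [show s * (x - y') + (1 - s) * (x' - y) = x - y by linear_combination -hsd] at e₁
  rw [show (1 - s) * (x - y') + s * (x' - y) = x' - y' by linear_combination hsd] at e₂
  linarith

/-- For monotone `H`, `G` with `H (u + 1) = H u + c` and `G (u + 1) = G u + c` and a convex
cost `φ`, the average cost along the shifted diagonal is a convex function of the shift. -/
theorem convexOn_integral_shift {φ H G : ℝ → ℝ} {c : ℝ} (hφ : ConvexOn ℝ Set.univ φ)
    (hH : Monotone H) (hG : Monotone G) (hH1 : ∀ u, H (u + 1) = H u + c)
    (hG1 : ∀ u, G (u + 1) = G u + c) :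
    ConvexOn ℝ Set.univ (fun α : ℝ => ∫ u in (0 : ℝ)..1, φ (H u - G (u + α))) := by
  have hφc : Continuous φ := hφ.locallyLipschitz.continuous
  have hmeas : ∀ a b : ℝ, Measurable fun u => φ (H (u + a) - G (u + b)) := fun a b =>
    hφc.measurable.comp ((hH.measurable.comp (measurable_add_const a)).sub
      (hG.measurable.comp (measurable_add_const b)))
  have hbound : ∀ a b b' : ℝ, ∃ C, ∀ t ∈ Set.Icc b b', ∀ u ∈ Set.uIoc (0 : ℝ) 1,
      ‖φ (H (u + a) - G (u + t))‖ ≤ C := by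
    intro a b b'
    obtain ⟨C, hC⟩ := (isCompact_Icc (a := H a - G (1 + b'))
      (b := H (1 + a) - G b)).exists_bound_of_continuousOn hφc.continuousOn
    refine ⟨C, fun t ht u hu => hC _ ?_⟩
    rw [Set.uIoc_of_le zero_le_one] at hu
    have := hu.1
    have := hu.2
    have := ht.1
    have := ht.2
    exact ⟨sub_le_sub (hH (by linarith)) (hG (by linarith)),
      sub_le_sub (hH (by linarith)) (hG (by linarith))⟩
  have hint : ∀ a b : ℝ, IntervalIntegrable (fun u => φ (H (u + a) - G (u + b))) volume 0 1 := by
    intro a b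
    obtain ⟨C, hC⟩ := hbound a b b
    refine (intervalIntegrable_const (c := C)).mono_fun (hmeas a b).aestronglyMeasurable ?_
    refine (ae_restrict_iff' measurableSet_uIoc).2 (ae_of_all _ fun u hu => ?_)
    exact (hC b ⟨le_rfl, le_rfl⟩ u hu).trans (le_abs_self C)
  have hshift : ∀ a b : ℝ, ∫ u in (0 : ℝ)..1, φ (H (u + a) - G (u + (b + a))) =
      ∫ u in (0 : ℝ)..1, φ (H u - G (u + b)) := by
    intro a b
    have hper : Function.Periodic (fun u => φ (H u - G (u + b))) 1 := fun u => by
      simp only [hH1, add_right_comm u 1 b, hG1, add_sub_add_right_eq_sub]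
    have h1 := hper.intervalIntegral_add_eq a 0
    have h2 := intervalIntegral.integral_comp_add_right (a := 0) (b := 1)
      (fun u => φ (H u - G (u + b))) a
    rw [zero_add, add_comm 1 a, h1, zero_add] at h2
    rw [← h2]
    simp only [add_assoc, add_comm a b]
  refine convexOn_univ_of_continuous_of_midpoint ?_ fun α h hh => ?_
  · refine continuous_iff_continuousAt.2 fun α => ?_
    obtain ⟨C, hC⟩ := hbound 0 (α - 1) (α + 1)
    simp only [add_zero] at hC
    refine intervalIntegral.continuousAt_of_dominated_interval (bound := fun _ => C)
      (Eventually.of_forall fun t => ?_) ?_ intervalIntegrable_const ?_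
    · simpa using (hmeas 0 t).aestronglyMeasurable
    · filter_upwards [Icc_mem_nhds (sub_one_lt α) (lt_add_one α)] with t ht
      exact ae_of_all _ fun u hu => hC t ht u hu
    · have hcount : ((fun u => u + α) ⁻¹' {v | ¬ContinuousAt G v}).Countable :=
        hG.countable_not_continuousAt.preimage (add_left_injective α)
      filter_upwards [hcount.ae_notMem volume] with u hu _
      have hGu : ContinuousAt G (u + α) := by simpa using hu
      exact hφc.continuousAt.comp (continuousAt_const.sub
        (ContinuousAt.comp (g := G) hGu (by fun_prop)))
  · have e₁ := hshift h α
    have e₂ := hshift h (α + h)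
    have i₁ := hint h (α + h)
    have i₂ := hint 0 (α + 2 * h)
    have i₃ := hint 0 (α + h)
    have i₄ := hint h (α + h + h)
    simp only [add_zero] at i₂ i₃
    rw [← e₁, two_mul (∫ u in (0 : ℝ)..1, φ (H u - G (u + (α + h))))]
    nth_rw 2 [← e₂]
    rw [← intervalIntegral.integral_add i₃ i₄, ← intervalIntegral.integral_add i₁ i₂]
    refine intervalIntegral.integral_mono_on zero_le_one (i₃.add i₄) (i₁.add i₂) fun u _ => ?_
    have := hφ.monge (hH (le_add_of_nonneg_right hh : u ≤ u + h))
      (hG (by linarith : u + (α + h) ≤ u + (α + 2 * h)))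
    rw [show α + h + h = α + 2 * h by ring]
    linarith

theorem convexOn_abs_rpow {p : ℝ} (hp : 1 ≤ p) :
    ConvexOn ℝ Set.univ (fun x : ℝ => |x| ^ p) := by
  refine ⟨convex_univ, fun x _ y _ a b ha hb hab => ?_⟩
  have h₁ : |a • x + b • y| ≤ a • |x| + b • |y| :=
    (convexOn_univ_norm (E := ℝ)).2 trivial trivial ha hb hab
  exact (rpow_le_rpow (abs_nonneg _) h₁ (by linarith)).trans
    ((convexOn_rpow hp).2 (abs_nonneg x) (abs_nonneg y) ha hb hab)

section circleCDF

variable {q : Measure ℝ} [IsProbabilityMeasure q]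

theorem floor_le_circleCDF (q : Measure ℝ) (x : ℝ) : (⌊x / (2 * π)⌋ : ℝ) ≤ circleCDF q x :=
  le_add_of_nonneg_right ENNReal.toReal_nonneg

theorem circleCDF_le_floor_add_one (x : ℝ) : circleCDF q x ≤ ⌊x / (2 * π)⌋ + 1 :=
  add_le_add_right (measureReal_le_one (μ := q)) _

theorem circleCDF_mono : Monotone (circleCDF q) := by
  intro x y hxy
  have hdiv : x / (2 * π) ≤ y / (2 * π) := div_le_div_of_nonneg_right hxy two_pi_pos.le
  rcases (Int.floor_le_floor hdiv).eq_or_lt with he | hlt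
  · have hfr : Int.fract (x / (2 * π)) ≤ Int.fract (y / (2 * π)) := by
      rw [Int.fract, Int.fract, he]
      linarith
    unfold circleCDF
    rw [he]
    gcongr
    exact measure_ne_top _ _
  · have hlt' : (⌊x / (2 * π)⌋ : ℝ) + 1 ≤ ⌊y / (2 * π)⌋ := by exact_mod_cast hlt
    exact (circleCDF_le_floor_add_one x).trans (hlt'.trans (floor_le_circleCDF q y))

theorem circleCDF_add_two_pi (q : Measure ℝ) (x : ℝ) :
    circleCDF q (x + 2 * π) = circleCDF q x + 1 := by
  have h : (x + 2 * π) / (2 * π) = x / (2 * π) + 1 := by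
    rw [add_div, div_self two_pi_pos.ne']
  rw [circleCDF, circleCDF, h, Int.floor_add_one, Int.fract_add_one]
  push_cast
  ring

theorem nonempty_le_circleCDF (q : Measure ℝ) (u : ℝ) : {x | u ≤ circleCDF q x}.Nonempty := by
  refine ⟨2 * π * ⌈u⌉, (Int.le_ceil u).trans ?_⟩
  have h := floor_le_circleCDF q (2 * π * ⌈u⌉)
  rwa [mul_div_cancel_left₀ _ two_pi_pos.ne', Int.floor_intCast] at h

theorem bddBelow_le_circleCDF (u : ℝ) : BddBelow {x | u ≤ circleCDF q x} := by
  refine ⟨(u - 1) * (2 * π), fun x hx => ?_⟩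
  rw [← le_div_iff₀ two_pi_pos]
  have h₁ : u ≤ circleCDF q x := hx
  have h₂ := circleCDF_le_floor_add_one (q := q) x
  have h₃ := Int.floor_le (x / (2 * π))
  linarith

theorem geninv_circleCDF_mono : Monotone (geninv (circleCDF q)) := fun u v huv =>
  csInf_le_csInf (bddBelow_le_circleCDF u) (nonempty_le_circleCDF q v) fun _ hx => huv.trans hx

theorem geninv_circleCDF_add_one (u : ℝ) :
    geninv (circleCDF q) (u + 1) = geninv (circleCDF q) u + 2 * π := by
  have himage : {x | u + 1 ≤ circleCDF q x} =
      OrderIso.addRight (2 * π) '' {x | u ≤ circleCDF q x} := by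
    ext x
    constructor
    · intro hx
      refine ⟨x - 2 * π, ?_, by simp⟩
      have h := circleCDF_add_two_pi q (x - 2 * π)
      rw [sub_add_cancel] at h
      have hx : u + 1 ≤ circleCDF q x := hx
      change u ≤ _
      linarith
    · rintro ⟨z, hz, rfl⟩
      have hz : u ≤ circleCDF q z := hz
      change u + 1 ≤ circleCDF q (z + 2 * π)
      rw [circleCDF_add_two_pi]
      linarith
  rw [geninv, himage, ← OrderIso.map_csInf' _ (nonempty_le_circleCDF q u)
    (bddBelow_le_circleCDF u)]
  rfl

end circleCDF

theorem geninv_sub_const (F : ℝ → ℝ) (α u : ℝ) :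
    geninv (fun x => F x - α) u = geninv F (u + α) := by
  simp only [geninv, le_sub_iff_add_le]

/-- the function `α ↦ ∫_0^1 |P_1^{-1}(u) − P_{2,α}^{-1}(u)|^p du` is convex
on `ℝ`, where `P_{2,α}(x) = P_2(x) − α`. -/
theorem quantile_objective_convex {p : ℝ} (hp : 1 ≤ p) (p₁ p₂ : Measure ℝ)
    (h₁ : IsCircleProb p₁) (h₂ : IsCircleProb p₂) :
    ConvexOn ℝ Set.univ (fun α : ℝ => ∫ u in (0:ℝ)..1,
      |geninv (circleCDF p₁) u - geninv (fun x => circleCDF p₂ x - α) u| ^ p) := by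
  have := h₁.1
  have := h₂.1
  simp only [geninv_sub_const]
  exact convexOn_integral_shift (convexOn_abs_rpow hp) geninv_circleCDF_mono
    geninv_circleCDF_mono geninv_circleCDF_add_one geninv_circleCDF_add_one
end

section
/- Let D ∈ ℕ with D ≥ 1 and let q̃ and p̃ be probability measures on the circle S¹ both supported on the grid {2πk/D : k = 1,…,D}, with circular cumulative distribution functions Q̃ and P̃. Let m be a median of the D values Q̃(2πk/D) − P̃(2πk/D), k = 1,…,D. Then W_1(q̃, p̃) = (2π/D) Σ_{i=1}^D |Q̃(2πi/D) − P̃(2πi/D) − m|. -/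
open MeasureTheory Real Filter
open scoped ENNReal

/-- The generalized inverse of the cumulative sums of `w 0, …, w (D - 1)`. -/
noncomputable def discreteQuantile (w : ℕ → ℝ) (D : ℕ) (t : ℝ) : ℕ :=
  ∑ j ∈ Finset.range D, if ∑ i ∈ Finset.range (j + 1), w i < t then 1 else 0

lemma measurable_discreteQuantile (w : ℕ → ℝ) (D : ℕ) : Measurable (discreteQuantile w D) := by
  unfold discreteQuantile
  refine Finset.measurable_sum _ fun j _ => ?_
  exact Measurable.ite measurableSet_Ioi measurable_const measurable_const

lemma monotone_sum_range {w : ℕ → ℝ} (hw : ∀ i, 0 ≤ w i) :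
    Monotone fun n => ∑ i ∈ Finset.range n, w i :=
  monotone_nat_of_le_succ fun n => by simp [Finset.sum_range_succ, hw]

lemma discreteQuantile_eq {w : ℕ → ℝ} (hw : ∀ i, 0 ≤ w i) {D k : ℕ} (hk : k < D) {t : ℝ}
    (ht : t ∈ Set.Ioc (∑ i ∈ Finset.range k, w i) (∑ i ∈ Finset.range (k + 1), w i)) :
    discreteQuantile w D t = k := by
  have key : ∀ j, (∑ i ∈ Finset.range (j + 1), w i < t) ↔ j < k := fun j => by
    constructor
    · intro h
      by_contra! hj
      have := monotone_sum_range hw (show k + 1 ≤ j + 1 by lia)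
      exact absurd ht.2 (not_le.2 (this.trans_lt h))
    · intro h
      exact (monotone_sum_range hw (show j + 1 ≤ k by lia)).trans_lt ht.1
  unfold discreteQuantile
  simp only [key]
  rw [← Finset.sum_filter]
  have : (Finset.range D).filter (fun j => j < k) = Finset.range k := by
    ext j; simp only [Finset.mem_filter, Finset.mem_range]; lia
  rw [this]; simp

lemma map_discreteQuantile {w : ℕ → ℝ} (hw : ∀ i, 0 ≤ w i) {D : ℕ}
    (hsum : ∑ i ∈ Finset.range D, w i = 1) (f : ℕ → ℝ) :
    (volume.restrict (Set.Ioc (0 : ℝ) 1)).map (fun t => f (discreteQuantile w D t)) =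
      ∑ k ∈ Finset.range D, ENNReal.ofReal (w k) • Measure.dirac (f k) := by
  have hmeas : Measurable fun t => f (discreteQuantile w D t) :=
    (measurable_of_countable f).comp (measurable_discreteQuantile w D)
  have main : ∀ n ≤ D, (volume.restrict (Set.Ioc (0 : ℝ) (∑ i ∈ Finset.range n, w i))).map
      (fun t => f (discreteQuantile w D t)) =
      ∑ k ∈ Finset.range n, ENNReal.ofReal (w k) • Measure.dirac (f k) := by
    intro n
    induction n with
    | zero => simp
    | succ n ih =>
      intro hn
      have h0 : 0 ≤ ∑ i ∈ Finset.range n, w i := Finset.sum_nonneg fun i _ => hw i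
      have h1 : ∑ i ∈ Finset.range n, w i ≤ ∑ i ∈ Finset.range (n + 1), w i :=
        monotone_sum_range hw n.le_succ
      rw [← Set.Ioc_union_Ioc_eq_Ioc h0 h1,
        Measure.restrict_union (Set.Ioc_disjoint_Ioc_of_le le_rfl) measurableSet_Ioc,
        Measure.map_add _ _ hmeas, ih (by lia),
        Finset.sum_range_succ fun k => ENNReal.ofReal (w k) • Measure.dirac (f k)]
      congr 1
      rw [Measure.map_congr (g := fun _ => f n), Measure.map_const]
      · simp [Finset.sum_range_succ]
      · filter_upwards [ae_restrict_mem measurableSet_Ioc] with t ht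
        rw [discreteQuantile_eq hw (show n < D by lia) ht]
  simpa [hsum] using main D le_rfl

lemma abs_discreteQuantile_sub_le (w v : ℕ → ℝ) (D : ℕ) (t : ℝ) :
    |(discreteQuantile w D t : ℝ) - discreteQuantile v D t| ≤
      ∑ j ∈ Finset.range D, (Set.uIoc (∑ i ∈ Finset.range (j + 1), w i)
        (∑ i ∈ Finset.range (j + 1), v i)).indicator (fun _ => (1 : ℝ)) t := by
  classical
  unfold discreteQuantile
  rw [Nat.cast_sum, Nat.cast_sum, ← Finset.sum_sub_distrib]
  refine (Finset.abs_sum_le_sum_abs _ _).trans (Finset.sum_le_sum fun j _ => ?_)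
  generalize ∑ i ∈ Finset.range (j + 1), w i = x
  generalize ∑ i ∈ Finset.range (j + 1), v i = y
  simp only [Set.indicator_apply, Set.mem_uIoc]
  split_ifs <;> simp <;> grind

lemma sum_range_add_of_periodic {M : Type*} [AddCommMonoid M] {g : ℕ → M} {D : ℕ}
    (hg : Function.Periodic g D) (l : ℕ) :
    ∑ j ∈ Finset.range D, g (l + j) = ∑ j ∈ Finset.range D, g j := by
  induction l with
  | zero => simp
  | succ l ih =>
    rw [← ih]
    cases D with
    | zero => simp
    | succ D =>
      rw [Finset.sum_range_succ, Finset.sum_range_succ' _ D]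
      congr 1
      · exact Finset.sum_congr rfl fun j _ => by congr 1; ring
      · rw [← hg (l + 0)]; congr 1; ring

/-- The sum of distances to the points of a finite family is minimized at one of the points. -/
lemma exists_sum_abs_sub_le {ι : Type*} {s : Finset ι} (hs : s.Nonempty) (F : ι → ℝ) (m : ℝ) :
    ∃ l ∈ s, ∑ k ∈ s, |F k - F l| ≤ ∑ k ∈ s, |F k - m| := by
  classical
  by_cases hlo : (s.filter fun k => F k ≤ m).Nonempty
  · obtain ⟨u, hu, humax⟩ := Finset.exists_max_image _ F hlo
    by_cases hhi : (s.filter fun k => m < F k).Nonempty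
    · obtain ⟨v, hv, hvmin⟩ := Finset.exists_min_image _ F hhi
      simp only [Finset.mem_filter] at hu hv humax hvmin
      by_contra! hcon
      have h1 := hcon u hu.1
      have h2 := hcon v hv.1
      have key : (F v - F u) * ∑ k ∈ s, |F k - m| =
          (F v - m) * ∑ k ∈ s, |F k - F u| + (m - F u) * ∑ k ∈ s, |F k - F v| := by
        simp only [Finset.mul_sum, ← Finset.sum_add_distrib]
        refine Finset.sum_congr rfl fun k hk => ?_
        rcases le_or_gt (F k) m with h | h
        · have := humax k ⟨hk, h⟩
          rw [abs_of_nonpos (by linarith), abs_of_nonpos (by linarith),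
            abs_of_nonpos (by linarith)]
          ring
        · have := hvmin k ⟨hk, h⟩
          rw [abs_of_nonneg (by linarith), abs_of_nonneg (by linarith),
            abs_of_nonneg (by linarith)]
          ring
      nlinarith [mul_lt_mul_of_pos_left h2 (sub_pos.2 hv.2),
        mul_lt_mul_of_pos_left h1 (sub_pos.2 hv.2),
        mul_le_mul_of_nonneg_left h2.le (sub_nonneg.2 hu.2)]
    · simp only [Finset.mem_filter] at hu humax
      refine ⟨u, hu.1, Finset.sum_le_sum fun k hk => ?_⟩
      have hkm : F k ≤ m := by
        by_contra! h
        exact hhi ⟨k, Finset.mem_filter.2 ⟨hk, h⟩⟩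
      have := humax k ⟨hk, hkm⟩
      rw [abs_of_nonpos (by linarith), abs_of_nonpos (by linarith)]
      linarith [hu.2]
  · obtain ⟨v, hv, hvmin⟩ := Finset.exists_min_image s F hs
    have hm : ∀ k ∈ s, m < F k := fun k hk => by
      by_contra! h
      exact hlo ⟨k, Finset.mem_filter.2 ⟨hk, h⟩⟩
    refine ⟨v, hv, Finset.sum_le_sum fun k hk => ?_⟩
    have := hvmin k hk
    have := hm v hv
    rw [abs_of_nonneg (by linarith), abs_of_nonneg (by linarith)]
    linarith

/-- The grid `2π/D, 4π/D, …, 2π`, extended to a `D`-periodic sequence. -/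
noncomputable def gridPoint (D n : ℕ) : ℝ := 2 * π * ((n % D + 1 : ℕ) : ℝ) / D

lemma gridPoint_periodic (D : ℕ) : Function.Periodic (gridPoint D) D := fun n => by
  simp [gridPoint]

lemma gridPoint_of_lt {D n : ℕ} (h : n < D) : gridPoint D n = 2 * π * ((n + 1 : ℕ) : ℝ) / D := by
  rw [gridPoint, Nat.mod_eq_of_lt h]

lemma grid_le_grid_iff {D : ℕ} (hD : 1 ≤ D) (i j : ℕ) :
    2 * π * (i : ℝ) / D ≤ 2 * π * (j : ℝ) / D ↔ i ≤ j := by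
  have hD0 : (0 : ℝ) < D := by exact_mod_cast hD
  rw [div_le_div_iff_of_pos_right hD0, mul_le_mul_iff_right₀ two_pi_pos, Nat.cast_le]

lemma gridPoint_injOn {D : ℕ} (hD : 1 ≤ D) :
    Set.InjOn (gridPoint D) (Finset.range D : Set ℕ) := by
  intro i hi j hj h
  simp only [Finset.coe_range, Set.mem_Iio] at hi hj
  rw [gridPoint_of_lt hi, gridPoint_of_lt hj] at h
  have h1 := (grid_le_grid_iff hD _ _).1 h.le
  have h2 := (grid_le_grid_iff hD _ _).1 h.ge
  lia

lemma circleDist_gridPoint_le {D : ℕ} (hD : 1 ≤ D) (i j : ℕ) :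
    circleDist (gridPoint D i) (gridPoint D j) ≤ 2 * π / D * |(i : ℝ) - j| := by
  have hD0 : (0 : ℝ) < D := by exact_mod_cast hD
  have hc : 0 < 2 * π / D := div_pos two_pi_pos hD0
  have hsub : gridPoint D i - gridPoint D j = 2 * π / D * ((i % D : ℕ) - (j % D : ℕ) : ℝ) := by
    simp only [gridPoint]; push_cast; ring
  have hD2 : 2 * π = 2 * π / D * D := by field_simp
  have hi : (i : ℝ) = D * (i / D : ℕ) + (i % D : ℕ) := by
    exact_mod_cast (Nat.div_add_mod i D).symm
  have hj : (j : ℝ) = D * (j / D : ℕ) + (j % D : ℕ) := by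
    exact_mod_cast (Nat.div_add_mod j D).symm
  rw [circleDist, hsub, abs_mul, abs_of_pos hc]
  by_cases h : i / D = j / D
  · refine (min_le_left _ _).trans (le_of_eq ?_)
    rw [hi, hj, h]; ring_nf
  · refine (min_le_right _ _).trans ?_
    have h1 : (1 : ℝ) ≤ |((i / D : ℕ) : ℝ) - (j / D : ℕ)| := by
      have : (1 : ℤ) ≤ |((i / D : ℕ) : ℤ) - (j / D : ℕ)| :=
        Int.one_le_abs (sub_ne_zero.2 (by exact_mod_cast h))
      exact_mod_cast this
    have h2 : (D : ℝ) ≤ |(D : ℝ) * (((i / D : ℕ) : ℝ) - (j / D : ℕ))| := by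
      rw [abs_mul, abs_of_pos hD0]; nlinarith
    have h3 : (D : ℝ) * (((i / D : ℕ) : ℝ) - (j / D : ℕ)) =
        ((i : ℝ) - j) - ((i % D : ℕ) - (j % D : ℕ) : ℝ) := by
      linear_combination hj - hi
    rw [h3] at h2
    have h4 := h2.trans (abs_sub _ _)
    have h5 := mul_le_mul_of_nonneg_left h4 hc.le
    linarith

section Grid

variable {D : ℕ} {q : Measure ℝ}

lemma eq_sum_dirac_gridPoint (hD : 1 ≤ D) [IsProbabilityMeasure q]
    (hq : q {x : ℝ | ∃ k ∈ Finset.Icc 1 D, x = 2 * π * k / D} = 1) :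
    q = ∑ k ∈ Finset.range D,
      ENNReal.ofReal (q.real {gridPoint D k}) • Measure.dirac (gridPoint D k) := by
  have hG : {x : ℝ | ∃ k ∈ Finset.Icc 1 D, x = 2 * π * k / D} =
      ⋃ k ∈ Finset.range D, {gridPoint D k} := by
    ext x
    simp only [Set.mem_ofPred_eq, Finset.mem_Icc, Set.mem_iUnion, Finset.mem_range,
      Set.mem_singleton_iff, exists_prop]
    constructor
    · rintro ⟨k, hk, rfl⟩
      refine ⟨k - 1, by lia, ?_⟩
      rw [gridPoint_of_lt (by lia), Nat.sub_add_cancel hk.1]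
    · rintro ⟨k, hk, rfl⟩
      exact ⟨k + 1, by lia, gridPoint_of_lt hk⟩
  rw [hG] at hq
  have hGm : MeasurableSet (⋃ k ∈ Finset.range D, {gridPoint D k}) :=
    Finset.measurableSet_biUnion _ fun k _ => measurableSet_singleton _
  ext s hs
  have h1 : q s = q (⋃ k ∈ Finset.range D, s ∩ {gridPoint D k}) := by
    rw [← Set.inter_iUnion₂]
    refine (measure_inter_conull ?_).symm
    rwa [prob_compl_eq_zero_iff hGm]
  rw [h1, measure_biUnion_finset ?_ fun k _ => hs.inter (measurableSet_singleton _)]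
  · simp only [Measure.coe_finsetSum, Finset.sum_apply, Measure.smul_apply, smul_eq_mul,
      Measure.dirac_apply' _ hs]
    refine Finset.sum_congr rfl fun k _ => ?_
    by_cases h : gridPoint D k ∈ s <;> simp [h]
  · intro i hi j hj hij
    refine Set.disjoint_left.2 fun x hx hx' => hij (gridPoint_injOn hD hi hj ?_)
    exact hx.2.symm.trans hx'.2

lemma real_Iic_grid (hD : 1 ≤ D) [IsProbabilityMeasure q]
    (hq : q {x : ℝ | ∃ k ∈ Finset.Icc 1 D, x = 2 * π * k / D} = 1) {k : ℕ} (hk : k ≤ D) :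
    q.real (Set.Iic (2 * π * k / D)) = ∑ i ∈ Finset.range k, q.real {gridPoint D i} := by
  have h : q (Set.Iic (2 * π * k / D)) =
      ∑ i ∈ Finset.range k, ENNReal.ofReal (q.real {gridPoint D i}) := by
    conv_lhs => rw [eq_sum_dirac_gridPoint hD hq]
    simp only [Measure.coe_finsetSum, Finset.sum_apply, Measure.smul_apply, smul_eq_mul,
      Measure.dirac_apply' _ measurableSet_Iic]
    rw [← Finset.sum_subset (Finset.range_subset_range.2 hk)]
    · refine Finset.sum_congr rfl fun i hi => ?_
      rw [Finset.mem_range] at hi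
      have : gridPoint D i ∈ Set.Iic (2 * π * k / D) := by
        rw [gridPoint_of_lt (by lia), Set.mem_Iic, grid_le_grid_iff hD]; lia
      simp [this]
    · intro i hi hik
      rw [Finset.mem_range] at hi hik
      have : gridPoint D i ∉ Set.Iic (2 * π * k / D) := by
        rw [gridPoint_of_lt hi, Set.mem_Iic, grid_le_grid_iff hD]; lia
      simp [this]
  rw [Measure.real, h, ENNReal.toReal_sum (by simp)]
  exact Finset.sum_congr rfl fun i _ => ENNReal.toReal_ofReal measureReal_nonneg

lemma ae_mem_grid [IsProbabilityMeasure q]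
    (hq : q {x : ℝ | ∃ k ∈ Finset.Icc 1 D, x = 2 * π * k / D} = 1) :
    ∀ᵐ x ∂q, ∃ k ∈ Finset.Icc 1 D, x = 2 * π * k / D := by
  have hm : MeasurableSet {x : ℝ | ∃ k ∈ Finset.Icc 1 D, x = 2 * π * k / D} := by
    refine Set.Finite.measurableSet (((Finset.Icc 1 D).finite_toSet.image
      fun k : ℕ => 2 * π * (k : ℝ) / D).subset ?_)
    rintro x ⟨k, hk, rfl⟩
    exact ⟨k, hk, rfl⟩
  exact (prob_compl_eq_zero_iff hm).2 hq

lemma sum_gridPoint_eq_one (hD : 1 ≤ D) [IsProbabilityMeasure q]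
    (hq : q {x : ℝ | ∃ k ∈ Finset.Icc 1 D, x = 2 * π * k / D} = 1) :
    ∑ i ∈ Finset.range D, q.real {gridPoint D i} = 1 := by
  rw [← real_Iic_grid hD hq le_rfl, Measure.real, ← ENNReal.toReal_one,
    ← measure_univ (μ := q)]
  congr 1
  refine measure_congr ?_
  filter_upwards [ae_mem_grid hq] with x hx
  obtain ⟨k, hk, rfl⟩ := hx
  exact propext (iff_true_intro
    ((grid_le_grid_iff hD k D).2 (Finset.mem_Icc.1 hk).2))

lemma circleCDF_grid (hD : 1 ≤ D) [IsProbabilityMeasure q]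
    (hq : q {x : ℝ | ∃ k ∈ Finset.Icc 1 D, x = 2 * π * k / D} = 1) {k : ℕ}
    (hk : k ∈ Finset.Icc 1 D) :
    circleCDF q (2 * π * k / D) = q.real (Set.Iic (2 * π * k / D)) := by
  have hD0 : (0 : ℝ) < D := by exact_mod_cast hD
  have hpos : ∀ᵐ x ∂q, 0 < x := by
    filter_upwards [ae_mem_grid hq] with x hx
    obtain ⟨i, hi, rfl⟩ := hx
    have : (0 : ℝ) < i := by exact_mod_cast (Finset.mem_Icc.1 hi).1
    have := pi_pos
    positivity
  rw [Finset.mem_Icc] at hk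
  have hdiv : 2 * π * k / D / (2 * π) = (k : ℝ) / D := by
    have := pi_ne_zero; field_simp
  rw [circleCDF, hdiv]
  rcases hk.2.lt_or_eq with h | rfl
  · have hlt : (k : ℝ) / D < 1 := (div_lt_one hD0).2 (by exact_mod_cast h)
    have hnn : 0 ≤ (k : ℝ) / D := by positivity
    rw [Int.floor_eq_zero_iff.2 ⟨hnn, hlt⟩, Int.fract_eq_self.2 ⟨hnn, hlt⟩, Int.cast_zero,
      zero_add, Measure.real, mul_div_assoc]
    congr 1
    refine measure_congr ?_
    filter_upwards [hpos] with x hx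
    exact propext ⟨fun h => h.2, fun h => ⟨hx.le, h⟩⟩
  · have h0 : q (Set.Icc 0 0) = 0 := by
      refine measure_mono_null (t := {x | ¬ 0 < x}) (fun x hx => not_lt.2 hx.2) hpos
    rw [div_self hD0.ne', Int.floor_one, Int.fract_one, mul_zero, h0,
      real_Iic_grid hD hq le_rfl, sum_gridPoint_eq_one hD hq]
    simp

end Grid

lemma circleW_one_eq (μ ν : Measure ℝ) :
    circleW 1 μ ν = ⨅ γ ∈ {γ : Measure (ℝ × ℝ) | IsProbabilityMeasure γ ∧
      γ.map Prod.fst = μ ∧ γ.map Prod.snd = ν},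
      ∫⁻ z, ENNReal.ofReal (circleDist z.1 z.2) ∂γ := by
  simp [circleW]

lemma measurable_circleDist : Measurable fun z : ℝ × ℝ => circleDist z.1 z.2 := by
  unfold circleDist; fun_prop

/-- The quantile coupling of two grid measures after cutting the circle at the grid point `l`. -/
lemma circleW_one_le (D : ℕ) (hD : 1 ≤ D) (q p : Measure ℝ)
    [IsProbabilityMeasure q] [IsProbabilityMeasure p]
    (hq : q {x : ℝ | ∃ k ∈ Finset.Icc 1 D, x = 2 * π * k / D} = 1)
    (hp : p {x : ℝ | ∃ k ∈ Finset.Icc 1 D, x = 2 * π * k / D} = 1) (l : ℕ) (F : ℕ → ℝ)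
    (hF : F = fun n => ∑ i ∈ Finset.range n, (q.real {gridPoint D i} - p.real {gridPoint D i})) :
    circleW 1 q p ≤ ENNReal.ofReal (2 * π / D * ∑ k ∈ Finset.range D, |F (k + 1) - F l|) := by
  have hc : 0 ≤ 2 * π / D := div_nonneg two_pi_pos.le D.cast_nonneg
  set w : ℕ → ℝ := fun i => q.real {gridPoint D (l + i)} with hw
  set v : ℕ → ℝ := fun i => p.real {gridPoint D (l + i)} with hv
  have hwper : Function.Periodic (fun i => q.real {gridPoint D i}) D := fun i => by
    simp [gridPoint_periodic D i]
  have hvper : Function.Periodic (fun i => p.real {gridPoint D i}) D := fun i => by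
    simp [gridPoint_periodic D i]
  have hw0 : ∀ i, 0 ≤ w i := fun i => measureReal_nonneg
  have hv0 : ∀ i, 0 ≤ v i := fun i => measureReal_nonneg
  have hw1 : ∑ i ∈ Finset.range D, w i = 1 :=
    (sum_range_add_of_periodic hwper l).trans (sum_gridPoint_eq_one hD hq)
  have hv1 : ∑ i ∈ Finset.range D, v i = 1 :=
    (sum_range_add_of_periodic hvper l).trans (sum_gridPoint_eq_one hD hp)
  have hwm := measurable_discreteQuantile w D
  have hvm := measurable_discreteQuantile v D
  have hm1 : Measurable fun t => gridPoint D (l + discreteQuantile w D t) :=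
    (measurable_of_countable fun n => gridPoint D (l + n)).comp hwm
  have hm2 : Measurable fun t => gridPoint D (l + discreteQuantile v D t) :=
    (measurable_of_countable fun n => gridPoint D (l + n)).comp hvm
  have hwq : (volume.restrict (Set.Ioc (0 : ℝ) 1)).map
      (fun t => gridPoint D (l + discreteQuantile w D t)) = q := by
    rw [map_discreteQuantile hw0 hw1 fun n => gridPoint D (l + n)]
    conv_rhs => rw [eq_sum_dirac_gridPoint hD hq]
    exact sum_range_add_of_periodic (g := fun k => ENNReal.ofReal (q.real {gridPoint D k}) •
      Measure.dirac (gridPoint D k)) (fun i => by simp [gridPoint_periodic D i]) l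
  have hvp : (volume.restrict (Set.Ioc (0 : ℝ) 1)).map
      (fun t => gridPoint D (l + discreteQuantile v D t)) = p := by
    rw [map_discreteQuantile hv0 hv1 fun n => gridPoint D (l + n)]
    conv_rhs => rw [eq_sum_dirac_gridPoint hD hp]
    exact sum_range_add_of_periodic (g := fun k => ENNReal.ofReal (p.real {gridPoint D k}) •
      Measure.dirac (gridPoint D k)) (fun i => by simp [gridPoint_periodic D i]) l
  have : IsProbabilityMeasure (volume.restrict (Set.Ioc (0 : ℝ) 1)) := ⟨by simp⟩
  rw [circleW_one_eq]
  refine (iInf₂_le ((volume.restrict (Set.Ioc (0 : ℝ) 1)).map fun t =>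
    (gridPoint D (l + discreteQuantile w D t), gridPoint D (l + discreteQuantile v D t)))
    ⟨Measure.isProbabilityMeasure_map (hm1.prodMk hm2).aemeasurable,
      (Measure.map_map measurable_fst (hm1.prodMk hm2)).trans hwq,
      (Measure.map_map measurable_snd (hm1.prodMk hm2)).trans hvp⟩).trans ?_
  rw [lintegral_map measurable_circleDist.ennreal_ofReal (hm1.prodMk hm2)]
  have hFD : Function.Periodic F D := fun n => by
    have h := sum_range_add_of_periodic (hwper.sub hvper) n
    simp only [Pi.sub_apply, Finset.sum_sub_distrib (s := Finset.range D)] at h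
    rw [sum_gridPoint_eq_one hD hq, sum_gridPoint_eq_one hD hp, sub_self] at h
    simp only [hF, Finset.sum_range_add]
    simpa using h
  have hFl : ∀ j, F (l + j) - F l =
      ∑ i ∈ Finset.range j, w i - ∑ i ∈ Finset.range j, v i := fun j => by
    simp only [hF, Finset.sum_range_add, hw, hv, Finset.sum_sub_distrib]
    ring
  have hrot : ∑ k ∈ Finset.range D, |F (k + 1) - F l| =
      ∑ k ∈ Finset.range D, |∑ i ∈ Finset.range (k + 1), v i - ∑ i ∈ Finset.range (k + 1), w i| := by
    rw [← sum_range_add_of_periodic (g := fun k => |F (k + 1) - F l|)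
      (fun k => by simp only [add_right_comm k D 1, hFD (k + 1)]) l]
    refine Finset.sum_congr rfl fun k _ => ?_
    rw [add_assoc, hFl, abs_sub_comm]
  calc ∫⁻ t in Set.Ioc (0 : ℝ) 1, ENNReal.ofReal (circleDist
        (gridPoint D (l + discreteQuantile w D t)) (gridPoint D (l + discreteQuantile v D t)))
      ≤ ∫⁻ t, ∑ j ∈ Finset.range D, (Set.uIoc (∑ i ∈ Finset.range (j + 1), w i)
        (∑ i ∈ Finset.range (j + 1), v i)).indicator (fun _ => ENNReal.ofReal (2 * π / D)) t := by
        refine (setLIntegral_le_lintegral _ _).trans (lintegral_mono fun t => ?_)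
        have h1 := circleDist_gridPoint_le hD (l + discreteQuantile w D t)
          (l + discreteQuantile v D t)
        push_cast at h1
        rw [add_sub_add_left_eq_sub] at h1
        have h2 := h1.trans
          (mul_le_mul_of_nonneg_left (abs_discreteQuantile_sub_le w v D t) hc)
        refine (ENNReal.ofReal_le_ofReal h2).trans (le_of_eq ?_)
        rw [Finset.mul_sum, ENNReal.ofReal_sum_of_nonneg]
        · refine Finset.sum_congr rfl fun j _ => ?_
          classical
          simp only [Set.indicator_apply]
          split_ifs <;> simp
        · intro j _
          exact mul_nonneg hc (Set.indicator_nonneg (fun _ _ => zero_le_one) _)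
    _ = ENNReal.ofReal (2 * π / D * ∑ k ∈ Finset.range D, |F (k + 1) - F l|) := by
        rw [lintegral_finsetSum _ fun j _ => measurable_const.indicator measurableSet_uIoc,
          hrot, Finset.mul_sum, ENNReal.ofReal_sum_of_nonneg fun j _ => mul_nonneg hc (abs_nonneg _)]
        refine Finset.sum_congr rfl fun j _ => ?_
        rw [lintegral_indicator_const measurableSet_uIoc, Real.volume_uIoc,
          ENNReal.ofReal_mul hc]

/-- The signed number of crossings of the cut at `2π` by the shortest path from `x` to `y`. -/
noncomputable def circleWinding (z : ℝ × ℝ) : ℝ :=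
  if |z.1 - z.2| ≤ π then 0 else if z.1 ≤ z.2 then 1 else -1

lemma measurable_circleWinding : Measurable circleWinding := by
  unfold circleWinding
  refine Measurable.ite (measurableSet_le (by fun_prop) measurable_const) measurable_const ?_
  exact Measurable.ite (measurableSet_le measurable_fst measurable_snd) measurable_const
    measurable_const

/-- The signed flow through the point `a` of the shortest path from `x` to `y`. -/
noncomputable def circleFlow (a : ℝ) (z : ℝ × ℝ) : ℝ :=
  (Set.Iic a).indicator (fun _ => (1 : ℝ)) z.1 - (Set.Iic a).indicator (fun _ => (1 : ℝ)) z.2 -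
    circleWinding z

lemma sum_indicator_grid {D : ℕ} (hD : 1 ≤ D) {i : ℕ} (hi : i ∈ Finset.Icc 1 D) :
    ∑ k ∈ Finset.Icc 1 D,
      (Set.Iic (2 * π * (k : ℝ) / D)).indicator (fun _ => (1 : ℝ)) (2 * π * i / D) =
      D + 1 - i := by
  simp only [Set.indicator_apply, Set.mem_Iic, grid_le_grid_iff hD]
  rw [Finset.mem_Icc] at hi
  rw [← Finset.sum_filter]
  have : (Finset.Icc 1 D).filter (fun k => i ≤ k) = Finset.Icc i D := by
    ext k; simp only [Finset.mem_filter, Finset.mem_Icc]; lia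
  rw [this, Finset.sum_const, Nat.card_Icc, nsmul_eq_mul, mul_one, Nat.cast_sub (by lia)]
  push_cast; ring

lemma abs_circleFlow_swap (a : ℝ) (z : ℝ × ℝ) : |circleFlow a z.swap| = |circleFlow a z| := by
  have h : circleWinding z.swap = -circleWinding z := by
    simp only [circleWinding, Prod.fst_swap, Prod.snd_swap, abs_sub_comm z.2 z.1]
    by_cases h : |z.1 - z.2| ≤ π
    · simp [h]
    · rcases lt_trichotomy z.1 z.2 with hlt | heq | hlt
      · simp [h, hlt.le, hlt.not_ge]
      · simp [heq, pi_pos.le] at h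
      · simp [h, hlt.le, hlt.not_ge]
  rw [← abs_neg (circleFlow a z)]
  simp only [circleFlow, h, Prod.fst_swap, Prod.snd_swap]
  congr 1
  ring

lemma sum_abs_circleFlow_of_le {D : ℕ} (hD : 1 ≤ D) {i j : ℕ} (hi : i ∈ Finset.Icc 1 D)
    (hj : j ∈ Finset.Icc 1 D) (hle : i ≤ j) :
    2 * π / D * ∑ k ∈ Finset.Icc 1 D,
      |circleFlow (2 * π * (k : ℝ) / D) (2 * π * i / D, 2 * π * j / D)| =
      circleDist (2 * π * i / D) (2 * π * j / D) := by
  have hD0 : (0 : ℝ) < D := by exact_mod_cast hD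
  have hD2 : 2 * π = 2 * π / D * D := by field_simp
  have hij := (grid_le_grid_iff hD i j).2 hle
  have habs : |2 * π * (i : ℝ) / D - 2 * π * j / D| = 2 * π / D * (j - i) := by
    rw [abs_of_nonpos (by linarith)]; ring
  have hsi := sum_indicator_grid hD hi
  have hsj := sum_indicator_grid hD hj
  have h0 : ∀ a : ℝ, 0 ≤ (Set.Iic a).indicator (fun _ => (1 : ℝ)) (2 * π * i / D) -
      (Set.Iic a).indicator (fun _ => (1 : ℝ)) (2 * π * j / D) := fun a => by
    simp only [Set.indicator_apply, Set.mem_Iic]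
    split_ifs <;> linarith
  have h1 : ∀ a : ℝ, (Set.Iic a).indicator (fun _ => (1 : ℝ)) (2 * π * i / D) -
      (Set.Iic a).indicator (fun _ => (1 : ℝ)) (2 * π * j / D) ≤ 1 := fun a => by
    simp only [Set.indicator_apply, Set.mem_Iic]
    split_ifs <;> norm_num
  by_cases hπ : |2 * π * (i : ℝ) / D - 2 * π * j / D| ≤ π
  · rw [circleDist, min_eq_left (by linarith), habs]
    simp only [circleFlow, circleWinding, hπ, if_true, sub_zero, abs_of_nonneg (h0 _)]
    rw [Finset.sum_sub_distrib, hsi, hsj]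
    ring
  · rw [circleDist, min_eq_right (by linarith), habs]
    simp only [circleFlow, circleWinding, hπ, hij, if_true, if_false,
      abs_of_nonpos (sub_nonpos.2 (h1 _)), neg_sub]
    rw [Finset.sum_sub_distrib, Finset.sum_sub_distrib, hsi, hsj, Finset.sum_const,
      Nat.card_Icc, nsmul_eq_mul, Nat.add_sub_cancel]
    linear_combination -hD2

lemma sum_abs_circleFlow {D : ℕ} (hD : 1 ≤ D) {i j : ℕ} (hi : i ∈ Finset.Icc 1 D)
    (hj : j ∈ Finset.Icc 1 D) :
    2 * π / D * ∑ k ∈ Finset.Icc 1 D,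
      |circleFlow (2 * π * (k : ℝ) / D) (2 * π * i / D, 2 * π * j / D)| =
      circleDist (2 * π * i / D) (2 * π * j / D) := by
  rcases le_total i j with h | h
  · exact sum_abs_circleFlow_of_le hD hi hj h
  · rw [circleDist, abs_sub_comm, ← circleDist, ← sum_abs_circleFlow_of_le hD hj hi h]
    exact congrArg _ (Finset.sum_congr rfl fun k _ => abs_circleFlow_swap _ (_, _))

lemma le_lintegral_circleDist (D : ℕ) (hD : 1 ≤ D) (q p : Measure ℝ)
    [IsProbabilityMeasure q] [IsProbabilityMeasure p]
    (hq : q {x : ℝ | ∃ k ∈ Finset.Icc 1 D, x = 2 * π * k / D} = 1)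
    (hp : p {x : ℝ | ∃ k ∈ Finset.Icc 1 D, x = 2 * π * k / D} = 1)
    (γ : Measure (ℝ × ℝ)) [IsProbabilityMeasure γ] (h1 : γ.map Prod.fst = q)
    (h2 : γ.map Prod.snd = p) :
    ∃ c : ℝ, ENNReal.ofReal (2 * π / D * ∑ k ∈ Finset.Icc 1 D,
      |q.real (Set.Iic (2 * π * k / D)) - p.real (Set.Iic (2 * π * k / D)) - c|) ≤
      ∫⁻ z, ENNReal.ofReal (circleDist z.1 z.2) ∂γ := by
  have hc : 0 ≤ 2 * π / D := div_nonneg two_pi_pos.le D.cast_nonneg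
  have hIw : Integrable circleWinding γ := by
    refine Integrable.of_bound measurable_circleWinding.aestronglyMeasurable 1
      (Eventually.of_forall fun z => ?_)
    unfold circleWinding
    split_ifs <;> simp
  have hI1 : ∀ a : ℝ, Integrable
      (fun z : ℝ × ℝ => (Set.Iic a).indicator (fun _ => (1 : ℝ)) z.1) γ := fun a =>
    (integrable_const (1 : ℝ)).indicator (measurable_fst measurableSet_Iic)
  have hI2 : ∀ a : ℝ, Integrable
      (fun z : ℝ × ℝ => (Set.Iic a).indicator (fun _ => (1 : ℝ)) z.2) γ := fun a =>
    (integrable_const (1 : ℝ)).indicator (measurable_snd measurableSet_Iic)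
  have hIF : ∀ a, Integrable (circleFlow a) γ := fun a => ((hI1 a).sub (hI2 a)).sub hIw
  have hint : ∀ a : ℝ, ∫ z, circleFlow a z ∂γ =
      q.real (Set.Iic a) - p.real (Set.Iic a) - ∫ z, circleWinding z ∂γ := fun a => by
    unfold circleFlow
    rw [integral_sub (f := fun z : ℝ × ℝ => (Set.Iic a).indicator (fun _ => (1 : ℝ)) z.1 -
      (Set.Iic a).indicator (fun _ => (1 : ℝ)) z.2) ((hI1 a).sub (hI2 a)) hIw,
      integral_sub (hI1 a) (hI2 a), ← h1, ← h2,
      map_measureReal_apply measurable_fst measurableSet_Iic,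
      map_measureReal_apply measurable_snd measurableSet_Iic]
    congr 2
    · exact (integral_indicator_const (1 : ℝ) (measurable_fst measurableSet_Iic)).trans (by simp)
    · exact (integral_indicator_const (1 : ℝ) (measurable_snd measurableSet_Iic)).trans (by simp)
  have hIs : Integrable (fun z => 2 * π / D * ∑ k ∈ Finset.Icc 1 D,
      |circleFlow (2 * π * (k : ℝ) / D) z|) γ :=
    (integrable_finsetSum _ fun k _ => (hIF _).abs).const_mul _
  refine ⟨∫ z, circleWinding z ∂γ, ?_⟩
  have hle : 2 * π / D * ∑ k ∈ Finset.Icc 1 D,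
      |q.real (Set.Iic (2 * π * k / D)) - p.real (Set.Iic (2 * π * k / D)) -
        ∫ z, circleWinding z ∂γ| ≤
      ∫ z, 2 * π / D * ∑ k ∈ Finset.Icc 1 D, |circleFlow (2 * π * (k : ℝ) / D) z| ∂γ := by
    rw [integral_const_mul, integral_finsetSum _ fun k _ => (hIF _).abs]
    refine mul_le_mul_of_nonneg_left (Finset.sum_le_sum fun k _ => ?_) hc
    rw [← hint]
    exact abs_integral_le_integral_abs
  refine (ENNReal.ofReal_le_ofReal hle).trans ?_
  rw [ofReal_integral_eq_lintegral_ofReal hIs (Eventually.of_forall fun z =>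
    mul_nonneg hc (Finset.sum_nonneg fun k _ => abs_nonneg _))]
  refine lintegral_mono_ae ?_
  have ha1 : ∀ᵐ z ∂γ, ∃ k ∈ Finset.Icc 1 D, z.1 = 2 * π * (k : ℝ) / D :=
    ae_of_ae_map measurable_fst.aemeasurable (h1 ▸ ae_mem_grid hq)
  have ha2 : ∀ᵐ z ∂γ, ∃ k ∈ Finset.Icc 1 D, z.2 = 2 * π * (k : ℝ) / D :=
    ae_of_ae_map measurable_snd.aemeasurable (h2 ▸ ae_mem_grid hp)
  filter_upwards [ha1, ha2] with ⟨x, y⟩ ⟨i, hi, hx⟩ ⟨j, hj, hy⟩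
  simp only at hx hy
  subst hx hy
  exact (congrArg ENNReal.ofReal (sum_abs_circleFlow hD hi hj)).le

/-- for probability measures `q̃, p̃` supported on the grid
`{2πk/D : k = 1,…,D}`, with `m` a median of the values
`Q̃(2πk/D) − P̃(2πk/D)` (`k = 1,…,D`), one has
`W_1(q̃, p̃) = (2π/D) Σ_{i=1}^D |Q̃(2πi/D) − P̃(2πi/D) − m|`. -/
theorem circleW_one_grid_median (D : ℕ) (hD : 1 ≤ D) (qt pt : Measure ℝ)
    (hqt : IsProbabilityMeasure qt) (hpt : IsProbabilityMeasure pt)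
    (hqs : qt {x : ℝ | ∃ k ∈ Finset.Icc 1 D, x = 2 * π * k / D} = 1)
    (hps : pt {x : ℝ | ∃ k ∈ Finset.Icc 1 D, x = 2 * π * k / D} = 1)
    (m : ℝ)
    (hm : ∀ c : ℝ,
      ∑ k ∈ Finset.Icc 1 D, |circleCDF qt (2 * π * k / D) - circleCDF pt (2 * π * k / D) - m| ≤
      ∑ k ∈ Finset.Icc 1 D, |circleCDF qt (2 * π * k / D) - circleCDF pt (2 * π * k / D) - c|) :
    (circleW 1 qt pt).toReal =
      (2 * π / D) *
        ∑ i ∈ Finset.Icc 1 D,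
          |circleCDF qt (2 * π * i / D) - circleCDF pt (2 * π * i / D) - m| := by
  have hc : 0 ≤ 2 * π / D := div_nonneg two_pi_pos.le D.cast_nonneg
  have hcdf : ∀ c : ℝ, ∑ k ∈ Finset.Icc 1 D,
      |circleCDF qt (2 * π * k / D) - circleCDF pt (2 * π * k / D) - c| =
      ∑ k ∈ Finset.Icc 1 D,
        |qt.real (Set.Iic (2 * π * k / D)) - pt.real (Set.Iic (2 * π * k / D)) - c| := fun c =>
    Finset.sum_congr rfl fun k hk => by
      rw [circleCDF_grid hD hqs hk, circleCDF_grid hD hps hk]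
  simp only [hcdf] at hm ⊢
  set S : ℝ := ∑ k ∈ Finset.Icc 1 D,
    |qt.real (Set.Iic (2 * π * k / D)) - pt.real (Set.Iic (2 * π * k / D)) - m| with hS
  have hS0 : 0 ≤ S := Finset.sum_nonneg fun k _ => abs_nonneg _
  suffices circleW 1 qt pt = ENNReal.ofReal (2 * π / D * S) by
    rw [this, ENNReal.toReal_ofReal (mul_nonneg hc hS0)]
  apply le_antisymm
  · set F : ℕ → ℝ := fun n => ∑ i ∈ Finset.range n,
      (qt.real {gridPoint D i} - pt.real {gridPoint D i}) with hF
    have hSF : S = ∑ k ∈ Finset.range D, |F (k + 1) - m| := by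
      rw [hS, Finset.range_eq_Ico, Finset.sum_Ico_add' (fun k => |F k - m|) 0 D 1]
      refine Finset.sum_congr (by ext k; simp only [Finset.mem_Icc, Finset.mem_Ico]; lia)
        fun k hk => ?_
      have hkD : k ≤ D := by rw [Finset.mem_Ico] at hk; lia
      rw [real_Iic_grid hD hqs hkD, real_Iic_grid hD hps hkD, ← Finset.sum_sub_distrib]
    obtain ⟨l, -, hl⟩ := exists_sum_abs_sub_le (s := Finset.range D)
      (Finset.nonempty_range_iff.2 (by lia)) (fun k => F (k + 1)) m
    rw [hSF]
    exact (circleW_one_le D hD qt pt hqs hps (l + 1) F hF).trans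
      (ENNReal.ofReal_le_ofReal (mul_le_mul_of_nonneg_left hl hc))
  · rw [circleW_one_eq]
    refine le_iInf₂ fun γ hγ => ?_
    have := hγ.1
    obtain ⟨c, hcγ⟩ := le_lintegral_circleDist D hD qt pt hqs hps γ hγ.2.1 hγ.2.2
    exact (ENNReal.ofReal_le_ofReal (mul_le_mul_of_nonneg_left (hm c) hc)).trans hcγ
end
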